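/- For every ε > 0 there exists δ > 0 such that the following holds. Let G be a finite group of order N and let A, B be subsets of G. If ∑_{g ∈ G} r_{A,B}(g)·r_{B,A}(g) ≤ δ·N³, then there exist subsets A′ ⊆ A and B′ ⊆ B with |A \ A′| ≤ ε·N and |B \ B′| ≤ ε·N such that |A′B′ ∩ B′A′| ≤ ε·N (almost all pairs do not commute). -/

import Mathlib

open scoped Pointwise

/-- The representation function `r_{A,B}(g) = |{(a,b) ∈ A × B : ab = g}|`. -/
def repFn {G : Type*} [Mul G] [DecidableEq G] (A B : Finset G) (g : G) : ℕ :=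
  ((A ×ˢ B).filter (fun p => p.1 * p.2 = g)).card

open Finset SimpleGraph SimpleGraph.TripartiteFromTriangles Sum3 in
/-- If `M` is a set of pairs in a finite group with pairwise distinct first entries, second entries
and products, then every set of pairs containing all `(x, y)` whose first entry, second entry and
product occur in `M` is large in terms of `M`, by the triangle removal lemma. -/
theorem triangleRemovalBound_mul_le_card_of_injOn {G : Type*} [Group G] [Fintype G]
    {ε : ℝ} {M S : Finset (G × G)}
    (h₁ : Set.InjOn Prod.fst (M : Set (G × G)))
    (h₂ : Set.InjOn Prod.snd (M : Set (G × G)))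
    (h₃ : Set.InjOn (fun p : G × G ↦ p.1 * p.2) (M : Set (G × G)))
    (hS : ∀ x y, (∃ p ∈ M, p.1 = x) → (∃ p ∈ M, p.2 = y) → (∃ p ∈ M, p.1 * p.2 = x * y) →
      (x, y) ∈ S)
    (hM : ε * Fintype.card G ≤ #M) :
    triangleRemovalBound (ε / 9) * 27 * (Fintype.card G : ℝ) ^ 2 ≤ #S := by
  classical
  let I (T : Finset (G × G)) : Finset (G × G × G) :=
    univ.filter fun t ↦ (t.1⁻¹ * t.2.1, t.2.1⁻¹ * t.2.2) ∈ T
  have mem_I (T : Finset (G × G)) (a b c : G) :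
      (a, b, c) ∈ I T ↔ (a⁻¹ * b, b⁻¹ * c) ∈ T := by simp [I]
  have card_I (T : Finset (G × G)) : #(I T) = Fintype.card G * #T := by
    rw [← card_univ, ← card_product]
    refine card_nbij' (fun t ↦ (t.1, t.1⁻¹ * t.2.1, t.2.1⁻¹ * t.2.2))
      (fun t ↦ (t.1, t.1 * t.2.1, t.1 * t.2.1 * t.2.2)) ?_ ?_ ?_ ?_
    · rintro ⟨a, b, c⟩ h
      simpa [I] using h
    · rintro ⟨a, b, c⟩ h
      simpa [I, mul_assoc] using h
    · rintro ⟨a, b, c⟩ -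
      simp
    · rintro ⟨a, b, c⟩ -
      simp [mul_assoc]
  have disj : ExplicitDisjoint (I M) := by
    constructor
    · intro a b c a' h h'
      rw [mem_I] at h h'
      simpa using congrArg Prod.fst (h₂ h h' rfl)
    · intro a b c b' h h'
      rw [mem_I] at h h'
      simpa using congrArg Prod.fst (h₃ h h' (by simp))
    · intro a b c c' h h'
      rw [mem_I] at h h'
      simpa using congrArg Prod.snd (h₁ h h' rfl)
  have hN : 0 < (Fintype.card G : ℝ) := by exact_mod_cast Fintype.card_pos
  have far : (graph (I M)).FarFromTriangleFree (ε / 9) := by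
    refine farFromTriangleFree _ ?_
    rw [card_I]
    push_cast
    nlinarith
  have lower := far.le_card_cliqueFinset
  have upper : #((graph (I M)).cliqueFinset 3) ≤ #(I S) := by
    refine (card_le_card fun s hs ↦ ?_).trans (card_image_le (s := I S) (f := toTriangle))
    rw [mem_cliqueFinset_iff, is3Clique_iff] at hs
    obtain ⟨x, y, z, hxy, hxz, hyz, rfl⟩ := hs
    obtain ⟨a, b, c, habc, hab, hac, hbc⟩ := graph_triple hxy hxz hyz
    obtain ⟨c', hc'⟩ := Graph.in₀₁_iff.1 hab
    obtain ⟨b', hb'⟩ := Graph.in₀₂_iff.1 hac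
    obtain ⟨a', ha'⟩ := Graph.in₁₂_iff.1 hbc
    rw [mem_I] at ha' hb' hc'
    refine mem_image.2 ⟨(a, b, c), (mem_I ..).2 (hS _ _ ?_ ?_ ?_), habc⟩
    · exact ⟨_, hc', rfl⟩
    · exact ⟨_, ha', rfl⟩
    · exact ⟨_, hb', by simp⟩
  rw [card_I] at upper
  have upper' : (#((graph (I M)).cliqueFinset 3) : ℝ) ≤ Fintype.card G * #S := by
    exact_mod_cast upper
  simp only [Fintype.card_sum] at lower
  push_cast at lower
  refine le_of_mul_le_mul_left ?_ hN
  linarith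

open Finset in
/-- The **removal lemma** for the equation `x * y = z` in finite groups. -/
theorem exists_group_removal {ε : ℝ} (hε : 0 < ε) :
    ∃ c : ℝ, 0 < c ∧ ∀ (G : Type*) [Group G] [Fintype G] [DecidableEq G] (X Y Z : Finset G),
      (#{p ∈ X ×ˢ Y | p.1 * p.2 ∈ Z} : ℝ) ≤ c * (Fintype.card G : ℝ) ^ 2 →
      ∃ X' ⊆ X, ∃ Y' ⊆ Y, (#(X \ X') : ℝ) ≤ ε * Fintype.card G ∧
        (#(Y \ Y') : ℝ) ≤ ε * Fintype.card G ∧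
        (#(X' * Y' ∩ Z) : ℝ) ≤ ε * Fintype.card G := by
  have hpos : 0 < SimpleGraph.triangleRemovalBound (ε / 9) :=
    SimpleGraph.triangleRemovalBound_pos (by positivity)
  refine ⟨SimpleGraph.triangleRemovalBound (ε / 9), hpos, fun G _ _ _ X Y Z hcard ↦ ?_⟩
  set S := {p ∈ X ×ˢ Y | p.1 * p.2 ∈ Z}
  have mem_S (x y : G) : (x, y) ∈ S ↔ (x ∈ X ∧ y ∈ Y) ∧ x * y ∈ Z := by simp [S]
  let P (M : Finset (G × G)) : Prop := Set.InjOn Prod.fst (M : Set (G × G)) ∧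
    Set.InjOn Prod.snd (M : Set (G × G)) ∧
    Set.InjOn (fun p : G × G ↦ p.1 * p.2) (M : Set (G × G))
  classical
  obtain ⟨M, hM, hmax⟩ := exists_max_image (S.powerset.filter P) card ⟨∅, by simp [P]⟩
  obtain ⟨hMS, h₁, h₂, h₃⟩ : M ⊆ S ∧ P M := by simpa using hM
  have hN : 0 < (Fintype.card G : ℝ) := by exact_mod_cast Fintype.card_pos
  have small : (#M : ℝ) ≤ ε * Fintype.card G := by
    by_contra! hlt
    have := triangleRemovalBound_mul_le_card_of_injOn (S := S) h₁ h₂ h₃ (by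
      rintro _ _ ⟨p, hp, rfl⟩ ⟨q, hq, rfl⟩ ⟨r, hr, hr'⟩
      rw [mem_S, ← hr']
      exact ⟨⟨((mem_S ..).1 (hMS hp)).1.1, ((mem_S ..).1 (hMS hq)).1.2⟩,
        ((mem_S ..).1 (hMS hr)).2⟩) hlt.le
    have : 0 < SimpleGraph.triangleRemovalBound (ε / 9) * (Fintype.card G : ℝ) ^ 2 := by
      positivity
    linarith
  have bound {f : G × G → G} {T : Finset G} (hT : T ⊆ M.image f) :
      (#T : ℝ) ≤ ε * Fintype.card G :=
    le_trans (by exact_mod_cast (card_le_card hT).trans card_image_le) small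
  refine ⟨X \ M.image Prod.fst, sdiff_subset, Y \ M.image Prod.snd, sdiff_subset,
    bound (f := Prod.fst) ?_, bound (f := Prod.snd) ?_, bound (f := fun p ↦ p.1 * p.2) ?_⟩
  · exact sdiff_sdiff_le
  · exact sdiff_sdiff_le
  · intro z hz
    obtain ⟨hxy, hzZ⟩ := mem_inter.1 hz
    obtain ⟨x, hx, y, hy, rfl⟩ := mem_mul.1 hxy
    rw [mem_sdiff] at hx hy
    by_contra hxyM
    have hnot : (x, y) ∉ M := fun h ↦ hx.2 (mem_image_of_mem Prod.fst h)
    have hins : insert (x, y) M ∈ S.powerset.filter P := by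
      simp only [mem_filter, mem_powerset, insert_subset_iff, P, coe_insert]
      refine ⟨⟨(mem_S ..).2 ⟨⟨hx.1, hy.1⟩, hzZ⟩, hMS⟩, ?_, ?_, ?_⟩ <;>
        rw [Set.injOn_insert (by exact_mod_cast hnot)]
      · exact ⟨h₁, by exact_mod_cast hx.2⟩
      · exact ⟨h₂, by exact_mod_cast hy.2⟩
      · exact ⟨h₃, by exact_mod_cast hxyM⟩
    have := hmax _ hins
    rw [card_insert_of_notMem hnot] at this
    omega

open Finset in
theorem card_filter_mul_mem_eq_sum_repFn {G : Type*} [Mul G] [DecidableEq G] (A B Z : Finset G) :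
    #{p ∈ A ×ˢ B | p.1 * p.2 ∈ Z} = ∑ g ∈ Z, repFn A B g := by
  rw [card_eq_sum_card_fiberwise (s := {p ∈ A ×ˢ B | p.1 * p.2 ∈ Z})
    (f := fun p : G × G ↦ p.1 * p.2) (t := Z) (fun p hp ↦ (mem_filter.1 (mem_coe.1 hp)).2)]
  refine sum_congr rfl fun g hg ↦ ?_
  rw [repFn, filter_filter]
  congr 1
  refine filter_congr fun p _ ↦ ⟨And.right, ?_⟩
  rintro rfl
  exact ⟨hg, rfl⟩

/-- For every `ε > 0` there is a `δ > 0` such that for every finite group `G` of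
order `N` and subsets `A, B ⊆ G`: if `∑_{g ∈ G} r_{A,B}(g)·r_{B,A}(g) ≤ δ·N³`,
then there are `A′ ⊆ A`, `B′ ⊆ B` with `|A \ A′| ≤ ε·N`, `|B \ B′| ≤ ε·N` and
`|A′B′ ∩ B′A′| ≤ ε·N` (almost all pairs do not commute). -/
theorem removal_noncommuting :
    ∀ ε : ℝ, 0 < ε → ∃ δ : ℝ, 0 < δ ∧
      ∀ (G : Type) [Group G] [Fintype G] [DecidableEq G] (A B : Finset G),
        (((∑ g : G, repFn A B g * repFn B A g : ℕ) : ℝ)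
            ≤ δ * (Fintype.card G : ℝ) ^ 3) →
        ∃ A' B' : Finset G,
          A' ⊆ A ∧ B' ⊆ B ∧
          ((A \ A').card : ℝ) ≤ ε * (Fintype.card G : ℝ) ∧
          ((B \ B').card : ℝ) ≤ ε * (Fintype.card G : ℝ) ∧
          (((A' * B') ∩ (B' * A')).card : ℝ) ≤ ε * (Fintype.card G : ℝ) := by
  intro ε hε
  obtain ⟨c, hc, removal⟩ := exists_group_removal (half_pos hε)
  refine ⟨c * c, mul_pos hc hc, fun G _ _ _ A B h ↦ ?_⟩
  have hN : 0 < (Fintype.card G : ℝ) := by exact_mod_cast Fintype.card_pos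
  set N : ℝ := (Fintype.card G : ℝ)
  let Z : Finset G := Finset.univ.filter fun g ↦ c * N ≤ repFn B A g
  have popular : (c * N) * (∑ g ∈ Z, (repFn A B g : ℝ)) ≤ (c * N) * (c * N ^ 2) := by
    calc
      _ = ∑ g ∈ Z, (repFn A B g : ℝ) * (c * N) := by rw [mul_comm, Finset.sum_mul]
      _ ≤ ∑ g ∈ Z, (repFn A B g : ℝ) * repFn B A g :=
        Finset.sum_le_sum fun g hg ↦
          mul_le_mul_of_nonneg_left (Finset.mem_filter.1 hg).2 (Nat.cast_nonneg _)
      _ ≤ ∑ g : G, (repFn A B g : ℝ) * repFn B A g :=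
        Finset.sum_le_sum_of_subset_of_nonneg (Finset.subset_univ _) fun _ _ _ ↦ by positivity
      _ ≤ c * c * N ^ 3 := by exact_mod_cast h
      _ = _ := by ring
  have unpopular : ∑ g ∈ Zᶜ, (repFn B A g : ℝ) ≤ c * N ^ 2 := by
    calc
      _ ≤ ∑ g ∈ Zᶜ, c * N := Finset.sum_le_sum fun g hg ↦ by
        have : ¬ c * N ≤ repFn B A g := by simpa [Z] using hg
        exact (not_le.1 this).le
      _ ≤ ∑ _g : G, c * N :=
        Finset.sum_le_sum_of_subset_of_nonneg (Finset.subset_univ _) fun _ _ _ ↦ by positivity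
      _ = c * N ^ 2 := by
        rw [Finset.sum_const, Finset.card_univ, nsmul_eq_mul]
        ring
  obtain ⟨A₁, hA₁, B₁, hB₁, hA₁c, hB₁c, h₁⟩ := removal G A B Z (by
    rw [card_filter_mul_mem_eq_sum_repFn]
    push_cast
    exact le_of_mul_le_mul_left popular (by positivity))
  obtain ⟨B₂, hB₂, A₂, hA₂, hB₂c, hA₂c, h₂⟩ := removal G B A Zᶜ (by
    rw [card_filter_mul_mem_eq_sum_repFn]
    push_cast
    exact unpopular)
  have union_bound {T U V : Finset G} (hT : T ⊆ U ∪ V) (hU : (U.card : ℝ) ≤ ε / 2 * N)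
      (hV : (V.card : ℝ) ≤ ε / 2 * N) : (T.card : ℝ) ≤ ε * N := by
    have : (T.card : ℝ) ≤ U.card + V.card := by
      exact_mod_cast (Finset.card_le_card hT).trans (Finset.card_union_le U V)
    linarith
  refine ⟨A₁ ∩ A₂, B₁ ∩ B₂, Finset.inter_subset_left.trans hA₁,
    Finset.inter_subset_left.trans hB₁, union_bound ?_ hA₁c hA₂c, union_bound ?_ hB₁c hB₂c,
    union_bound ?_ h₁ h₂⟩
  · exact sdiff_inf.le
  · exact sdiff_inf.le
  · intro g hg
    obtain ⟨hAB, hBA⟩ := Finset.mem_inter.1 hg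
    have hAB' : g ∈ A₁ * B₁ :=
      Finset.mul_subset_mul Finset.inter_subset_left Finset.inter_subset_left hAB
    have hBA' : g ∈ B₂ * A₂ :=
      Finset.mul_subset_mul Finset.inter_subset_right Finset.inter_subset_right hBA
    by_cases hgZ : g ∈ Z
    · exact Finset.mem_union_left _ (Finset.mem_inter.2 ⟨hAB', hgZ⟩)
    · exact Finset.mem_union_right _ (Finset.mem_inter.2 ⟨hBA', Finset.mem_compl.2 hgZ⟩)
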